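/- Let a, b ∈ ℝ and let m ≥ 1 be an integer. For every ε > 0 there exists a constant c > 0, depending only on a, b, m and ε, such that for all smooth periodic functions u₁, u₂ : ℝ² → ℝ, writing v = u₂ − u₁, |(A^m v, A^m(f(u₂) − f(u₁)))| ≤ ε ‖A^{m+1}v‖² + c ‖A^m v‖² (1 + ‖A^m u₁‖⁴ + ‖A^m u₂‖⁴), where f(u) = (a+3)u − 4Au + b|∇u|² + u³. -/

import Mathlib

open MeasureTheory Real Filter

noncomputable section

/-- A function `u : ℝ² → ℝ` is smooth periodic if it is `C^∞` and `2π`-periodic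
in each variable. -/
def SmoothPeriodic (u : ℝ × ℝ → ℝ) : Prop :=
  ContDiff ℝ (⊤ : ℕ∞) u ∧ (∀ x y, u (x + 2 * Real.pi, y) = u (x, y)) ∧
    (∀ x y, u (x, y + 2 * Real.pi) = u (x, y))

/-- Partial derivative in the first variable. -/
def pdx (u : ℝ × ℝ → ℝ) : ℝ × ℝ → ℝ := fun p => fderiv ℝ u p (1, 0)

/-- Partial derivative in the second variable. -/
def pdy (u : ℝ × ℝ → ℝ) : ℝ × ℝ → ℝ := fun p => fderiv ℝ u p (0, 1)

/-- The fundamental domain `[0, 2π]²`. -/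
def sq2 : Set (ℝ × ℝ) := Set.Icc (0 : ℝ) (2 * Real.pi) ×ˢ Set.Icc (0 : ℝ) (2 * Real.pi)

/-- The `L²` inner product over `[0, 2π]²`. -/
def l2inner (u v : ℝ × ℝ → ℝ) : ℝ := ∫ p in sq2, u p * v p

/-- The `L²` norm over `[0, 2π]²`. -/
def l2norm (u : ℝ × ℝ → ℝ) : ℝ := Real.sqrt (∫ p in sq2, (u p) ^ 2)

/-- The `L^q` norm over `[0, 2π]²`. -/
def lpnorm (q : ℝ) (u : ℝ × ℝ → ℝ) : ℝ := (∫ p in sq2, |u p| ^ q) ^ (1 / q)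

/-- The operator `A = -Δ + 1`. -/
def Aop (u : ℝ × ℝ → ℝ) : ℝ × ℝ → ℝ :=
  fun p => -(pdx (pdx u) p + pdy (pdy u) p) + u p

/-- The pointwise dot product of gradients, `∇v ⋅ ∇w`. -/
def gradDot (v w : ℝ × ℝ → ℝ) : ℝ × ℝ → ℝ :=
  fun p => pdx v p * pdx w p + pdy v p * pdy w p

/-- The nonlinearity `f(u) = (a+3)u − 4Au + b|∇u|² + u³`. -/
def fNL (a b : ℝ) (u : ℝ × ℝ → ℝ) : ℝ × ℝ → ℝ :=
  fun p => (a + 3) * u p - 4 * Aop u p + b * gradDot u u p + (u p) ^ 3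

namespace SmoothPeriodic

variable {u v : ℝ × ℝ → ℝ}

theorem continuous (hu : SmoothPeriodic u) : Continuous u := hu.1.continuous

theorem differentiable (hu : SmoothPeriodic u) : Differentiable ℝ u :=
  hu.1.differentiable (by simp)

theorem integrableOn (hu : SmoothPeriodic u) : IntegrableOn u sq2 :=
  hu.continuous.continuousOn.integrableOn_compact (isCompact_Icc.prod isCompact_Icc)

theorem const (c : ℝ) : SmoothPeriodic fun _ => c :=
  ⟨contDiff_const, fun _ _ => rfl, fun _ _ => rfl⟩

theorem add (hu : SmoothPeriodic u) (hv : SmoothPeriodic v) :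
    SmoothPeriodic fun p => u p + v p :=
  ⟨hu.1.add hv.1, fun x y => by simp only [hu.2.1, hv.2.1],
    fun x y => by simp only [hu.2.2, hv.2.2]⟩

theorem sub (hu : SmoothPeriodic u) (hv : SmoothPeriodic v) :
    SmoothPeriodic fun p => u p - v p :=
  ⟨hu.1.sub hv.1, fun x y => by simp only [hu.2.1, hv.2.1],
    fun x y => by simp only [hu.2.2, hv.2.2]⟩

theorem mul (hu : SmoothPeriodic u) (hv : SmoothPeriodic v) :
    SmoothPeriodic fun p => u p * v p :=
  ⟨hu.1.mul hv.1, fun x y => by simp only [hu.2.1, hv.2.1],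
    fun x y => by simp only [hu.2.2, hv.2.2]⟩

theorem const_mul (c : ℝ) (hu : SmoothPeriodic u) : SmoothPeriodic fun p => c * u p :=
  (const c).mul hu

theorem neg (hu : SmoothPeriodic u) : SmoothPeriodic fun p => -u p :=
  ⟨hu.1.neg, fun x y => by simp only [hu.2.1], fun x y => by simp only [hu.2.2]⟩

theorem sq (hu : SmoothPeriodic u) : SmoothPeriodic fun p => u p ^ 2 := by
  simpa only [pow_two] using hu.mul hu

theorem fderiv_apply (hu : SmoothPeriodic u) (w : ℝ × ℝ) :
    SmoothPeriodic fun p => fderiv ℝ u p w := by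
  have shift (d : ℝ × ℝ) (hd : (fun p => u (p + d)) = u) (p : ℝ × ℝ) :
      fderiv ℝ u (p + d) = fderiv ℝ u p := by
    rw [← fderiv_comp_add_right, hd]
  refine ⟨(hu.1.fderiv_right (by simp)).clm_apply contDiff_const, fun x y => ?_, fun x y => ?_⟩
  · have := shift (2 * Real.pi, 0) (by ext ⟨x, y⟩; simpa using hu.2.1 x y) (x, y)
    simp only [Prod.mk_add_mk, add_zero] at this
    simp only [this]
  · have := shift (0, 2 * Real.pi) (by ext ⟨x, y⟩; simpa using hu.2.2 x y) (x, y)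
    simp only [Prod.mk_add_mk, add_zero] at this
    simp only [this]

theorem pdx (hu : SmoothPeriodic u) : SmoothPeriodic (pdx u) := hu.fderiv_apply _

theorem pdy (hu : SmoothPeriodic u) : SmoothPeriodic (pdy u) := hu.fderiv_apply _

theorem Aop (hu : SmoothPeriodic u) : SmoothPeriodic (Aop u) :=
  ((hu.pdx.pdx.add hu.pdy.pdy).neg).add hu

theorem Aop_iterate (hu : SmoothPeriodic u) (m : ℕ) : SmoothPeriodic (_root_.Aop^[m] u) := by
  induction m generalizing u with
  | zero => exact hu
  | succ m ih => exact ih hu.Aop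

theorem hasDerivAt_fst (hu : SmoothPeriodic u) (x y : ℝ) :
    HasDerivAt (fun t => u (t, y)) (_root_.pdx u (x, y)) x :=
  (hu.differentiable (x, y)).hasFDerivAt.comp_hasDerivAt x
    ((hasDerivAt_id x).prodMk (hasDerivAt_const x y))

theorem hasDerivAt_snd (hu : SmoothPeriodic u) (x y : ℝ) :
    HasDerivAt (fun t => u (x, t)) (_root_.pdy u (x, y)) y :=
  (hu.differentiable (x, y)).hasFDerivAt.comp_hasDerivAt y
    ((hasDerivAt_const y x).prodMk (hasDerivAt_id y))

end SmoothPeriodic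

section Derivatives

variable {u v : ℝ × ℝ → ℝ}

theorem pdx_add (hu : SmoothPeriodic u) (hv : SmoothPeriodic v) :
    pdx (fun p => u p + v p) = fun p => pdx u p + pdx v p := by
  ext p
  simp [pdx, fderiv_fun_add (hu.differentiable p) (hv.differentiable p)]

theorem pdy_add (hu : SmoothPeriodic u) (hv : SmoothPeriodic v) :
    pdy (fun p => u p + v p) = fun p => pdy u p + pdy v p := by
  ext p
  simp [pdy, fderiv_fun_add (hu.differentiable p) (hv.differentiable p)]

theorem pdx_mul (hu : SmoothPeriodic u) (hv : SmoothPeriodic v) :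
    pdx (fun p => u p * v p) = fun p => pdx u p * v p + u p * pdx v p := by
  ext p
  simp [pdx, fderiv_fun_mul (hu.differentiable p) (hv.differentiable p)]
  ring

theorem pdy_mul (hu : SmoothPeriodic u) (hv : SmoothPeriodic v) :
    pdy (fun p => u p * v p) = fun p => pdy u p * v p + u p * pdy v p := by
  ext p
  simp [pdy, fderiv_fun_mul (hu.differentiable p) (hv.differentiable p)]
  ring

theorem pdx_const_mul (c : ℝ) (hu : SmoothPeriodic u) :
    pdx (fun p => c * u p) = fun p => c * pdx u p := by
  ext p
  simp [pdx, fderiv_const_mul (hu.differentiable p)]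

theorem pdy_const_mul (c : ℝ) (hu : SmoothPeriodic u) :
    pdy (fun p => c * u p) = fun p => c * pdy u p := by
  ext p
  simp [pdy, fderiv_const_mul (hu.differentiable p)]

theorem pdx_pdy_comm (hu : SmoothPeriodic u) : pdx (pdy u) = pdy (pdx u) := by
  ext p
  have h2 : (2 : WithTop ℕ∞) ≤ ((⊤ : ℕ∞) : WithTop ℕ∞) :=
    WithTop.coe_le_coe.2 (le_top : (2 : ℕ∞) ≤ ⊤)
  have hd : DifferentiableAt ℝ (fderiv ℝ u) p :=
    ((hu.1.fderiv_right (m := 1) (by norm_num; exact h2)).differentiable (by simp)) p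
  have hs : IsSymmSndFDerivAt ℝ u p :=
    hu.1.contDiffAt.isSymmSndFDerivAt (by simpa using h2)
  have key (w z : ℝ × ℝ) :
      fderiv ℝ (fun q => fderiv ℝ u q w) p z = fderiv ℝ (fderiv ℝ u) p z w := by
    rw [fderiv_clm_apply hd (differentiableAt_const _)]
    simp
  change fderiv ℝ (fun q => fderiv ℝ u q (0, 1)) p (1, 0) =
    fderiv ℝ (fun q => fderiv ℝ u q (1, 0)) p (0, 1)
  rw [key, key, hs.eq]

theorem pdx_Aop (hu : SmoothPeriodic u) : pdx (Aop u) = Aop (pdx u) := by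
  have h : Aop u = fun p => -1 * (pdx (pdx u) p + pdy (pdy u) p) + u p := by
    ext p; simp [Aop]
  rw [h, pdx_add ((hu.pdx.pdx.add hu.pdy.pdy).const_mul _) hu,
    pdx_const_mul _ (hu.pdx.pdx.add hu.pdy.pdy), pdx_add hu.pdx.pdx hu.pdy.pdy,
    pdx_pdy_comm hu.pdy, pdx_pdy_comm hu]
  ext p; simp [Aop]

theorem pdy_Aop (hu : SmoothPeriodic u) : pdy (Aop u) = Aop (pdy u) := by
  have h : Aop u = fun p => -1 * (pdx (pdx u) p + pdy (pdy u) p) + u p := by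
    ext p; simp [Aop]
  rw [h, pdy_add ((hu.pdx.pdx.add hu.pdy.pdy).const_mul _) hu,
    pdy_const_mul _ (hu.pdx.pdx.add hu.pdy.pdy), pdy_add hu.pdx.pdx hu.pdy.pdy,
    ← pdx_pdy_comm hu.pdx, ← pdx_pdy_comm hu]
  ext p; simp [Aop]

end Derivatives

section IntegrationByParts

variable {u v : ℝ × ℝ → ℝ}

theorem setIntegral_sq2 (hu : SmoothPeriodic u) :
    ∫ p in sq2, u p =
      ∫ x in Set.Icc 0 (2 * Real.pi), ∫ y in Set.Icc 0 (2 * Real.pi), u (x, y) :=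
  setIntegral_prod u hu.integrableOn

theorem setIntegral_sq2_symm (hu : SmoothPeriodic u) :
    ∫ p in sq2, u p =
      ∫ y in Set.Icc 0 (2 * Real.pi), ∫ x in Set.Icc 0 (2 * Real.pi), u (x, y) := by
  rw [setIntegral_sq2 hu]
  refine integral_integral_swap ?_
  rw [Measure.prod_restrict]
  exact hu.integrableOn

theorem setIntegral_pdx (hu : SmoothPeriodic u) : ∫ p in sq2, pdx u p = 0 := by
  rw [setIntegral_sq2_symm hu.pdx]
  refine integral_eq_zero_of_ae (.of_forall fun y => ?_)
  simp only [Pi.zero_apply]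
  rw [integral_Icc_eq_integral_Ioc, ← intervalIntegral.integral_of_le (by positivity),
    intervalIntegral.integral_eq_sub_of_hasDerivAt (fun x _ => hu.hasDerivAt_fst x y)
      ((hu.pdx.continuous.comp (by fun_prop)).intervalIntegrable _ _)]
  have := hu.2.1 0 y
  rw [zero_add] at this
  rw [this, sub_self]

theorem setIntegral_pdy (hu : SmoothPeriodic u) : ∫ p in sq2, pdy u p = 0 := by
  rw [setIntegral_sq2 hu.pdy]
  refine integral_eq_zero_of_ae (.of_forall fun x => ?_)
  simp only [Pi.zero_apply]
  rw [integral_Icc_eq_integral_Ioc, ← intervalIntegral.integral_of_le (by positivity),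
    intervalIntegral.integral_eq_sub_of_hasDerivAt (fun y _ => hu.hasDerivAt_snd x y)
      ((hu.pdy.continuous.comp (by fun_prop)).intervalIntegrable _ _)]
  have := hu.2.2 x 0
  rw [zero_add] at this
  rw [this, sub_self]

theorem l2inner_comm (u v : ℝ × ℝ → ℝ) : l2inner u v = l2inner v u := by
  simp only [l2inner, mul_comm]

theorem l2inner_pdx (hu : SmoothPeriodic u) (hv : SmoothPeriodic v) :
    l2inner (pdx u) v = -l2inner u (pdx v) := by
  have h := setIntegral_pdx (hu.mul hv)
  rw [pdx_mul hu hv, integral_add (hu.pdx.mul hv).integrableOn (hu.mul hv.pdx).integrableOn] at h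
  exact eq_neg_of_add_eq_zero_left h

theorem l2inner_pdy (hu : SmoothPeriodic u) (hv : SmoothPeriodic v) :
    l2inner (pdy u) v = -l2inner u (pdy v) := by
  have h := setIntegral_pdy (hu.mul hv)
  rw [pdy_mul hu hv, integral_add (hu.pdy.mul hv).integrableOn (hu.mul hv.pdy).integrableOn] at h
  exact eq_neg_of_add_eq_zero_left h

theorem l2inner_Aop (hu : SmoothPeriodic u) (hv : SmoothPeriodic v) :
    l2inner (Aop u) v = -l2inner (pdx (pdx u)) v - l2inner (pdy (pdy u)) v + l2inner u v := by
  have hx := (hu.pdx.pdx.mul hv).integrableOn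
  have hy := (hu.pdy.pdy.mul hv).integrableOn
  have h : l2inner (Aop u) v = ∫ p in sq2,
      -(pdx (pdx u) p * v p + pdy (pdy u) p * v p) + u p * v p :=
    integral_congr_ae (.of_forall fun p => by simp only [Aop]; ring)
  rw [h, integral_add ((hu.pdx.pdx.mul hv).add (hu.pdy.pdy.mul hv)).neg.integrableOn
    (hu.mul hv).integrableOn, integral_neg, integral_add hx hy]
  simp only [l2inner]
  ring

theorem l2inner_Aop_left (hu : SmoothPeriodic u) (hv : SmoothPeriodic v) :
    l2inner (Aop u) v = l2inner u (Aop v) := by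
  rw [l2inner_comm u, l2inner_Aop hu hv, l2inner_Aop hv hu, l2inner_pdx hu.pdx hv,
    l2inner_pdy hu.pdy hv, l2inner_pdx hv.pdx hu, l2inner_pdy hv.pdy hu,
    l2inner_comm (pdx v), l2inner_comm (pdy v), l2inner_comm v]

end IntegrationByParts

/-- The squared Sobolev norm of order `k`: the sum of `‖D u‖²` over all words `D` of length at
most `k` in the two partial derivatives, a word of length `j` being counted with the number of
its placements among `k` slots. -/
def sobolevSq : ℕ → (ℝ × ℝ → ℝ) → ℝ
  | 0, u => ∫ p in sq2, u p ^ 2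
  | k + 1, u => sobolevSq k u + sobolevSq k (pdx u) + sobolevSq k (pdy u)

theorem sobolevSq_nonneg (k : ℕ) (u : ℝ × ℝ → ℝ) : 0 ≤ sobolevSq k u := by
  induction k generalizing u with
  | zero => exact integral_nonneg fun p => sq_nonneg _
  | succ k ih => exact add_nonneg (add_nonneg (ih _) (ih _)) (ih _)

theorem sobolevSq_le_succ (k : ℕ) (u : ℝ × ℝ → ℝ) : sobolevSq k u ≤ sobolevSq (k + 1) u := by
  have := sobolevSq_nonneg k (pdx u)
  have := sobolevSq_nonneg k (pdy u)
  simp only [sobolevSq]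
  linarith

theorem sobolevSq_pdx_le (k : ℕ) (u : ℝ × ℝ → ℝ) :
    sobolevSq k (pdx u) ≤ sobolevSq (k + 1) u := by
  have := sobolevSq_nonneg k u
  have := sobolevSq_nonneg k (pdy u)
  simp only [sobolevSq]
  linarith

theorem sobolevSq_pdy_le (k : ℕ) (u : ℝ × ℝ → ℝ) :
    sobolevSq k (pdy u) ≤ sobolevSq (k + 1) u := by
  have := sobolevSq_nonneg k u
  have := sobolevSq_nonneg k (pdx u)
  simp only [sobolevSq]
  linarith

theorem sobolevSq_zero_eq_l2inner (u : ℝ × ℝ → ℝ) : sobolevSq 0 u = l2inner u u := by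
  simp only [sobolevSq, l2inner, pow_two]

theorem l2norm_sq (u : ℝ × ℝ → ℝ) : l2norm u ^ 2 = sobolevSq 0 u :=
  Real.sq_sqrt (sobolevSq_nonneg 0 u)

section Sobolev

variable {u v : ℝ × ℝ → ℝ}

theorem sobolevSq_add_le (k : ℕ) (hu : SmoothPeriodic u) (hv : SmoothPeriodic v) :
    sobolevSq k (fun p => u p + v p) ≤ 2 * (sobolevSq k u + sobolevSq k v) := by
  induction k generalizing u v with
  | zero =>
    simp only [sobolevSq]
    rw [← integral_add hu.sq.integrableOn hv.sq.integrableOn, ← integral_const_mul]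
    exact integral_mono (hu.add hv).sq.integrableOn
      ((hu.sq.add hv.sq).const_mul 2).integrableOn fun p => add_sq_le
  | succ k ih =>
    simp only [sobolevSq, pdx_add hu hv, pdy_add hu hv]
    linarith [ih hu hv, ih hu.pdx hv.pdx, ih hu.pdy hv.pdy]

theorem sobolevSq_const_mul (k : ℕ) (c : ℝ) (hu : SmoothPeriodic u) :
    sobolevSq k (fun p => c * u p) = c ^ 2 * sobolevSq k u := by
  induction k generalizing u with
  | zero => simp only [sobolevSq, mul_pow, integral_const_mul]
  | succ k ih =>
    simp only [sobolevSq, pdx_const_mul c hu, pdy_const_mul c hu, ih hu, ih hu.pdx, ih hu.pdy]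
    ring

theorem sobolevSq_add_two (k : ℕ) (hu : SmoothPeriodic u) :
    sobolevSq (k + 2) u = sobolevSq k (Aop u) := by
  induction k generalizing u with
  | zero =>
    have hxx : l2inner (pdx (pdx u)) u = -l2inner (pdx u) (pdx u) := l2inner_pdx hu.pdx hu
    have hyy : l2inner (pdy (pdy u)) u = -l2inner (pdy u) (pdy u) := l2inner_pdy hu.pdy hu
    have hxy : l2inner (pdx (pdx u)) (pdy (pdy u)) = l2inner (pdy (pdx u)) (pdy (pdx u)) := by
      rw [l2inner_pdx hu.pdx hu.pdy.pdy, pdx_pdy_comm hu.pdy, l2inner_comm,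
        l2inner_pdy hu.pdy.pdx hu.pdx, neg_neg, pdx_pdy_comm hu]
    have h := l2inner_Aop hu hu.Aop
    rw [l2inner_comm (pdx (pdx u)), l2inner_comm (pdy (pdy u)), l2inner_comm u (Aop u),
      l2inner_Aop hu hu.pdx.pdx, l2inner_Aop hu hu.pdy.pdy, l2inner_Aop hu hu,
      l2inner_comm (pdy (pdy u)) (pdx (pdx u)), l2inner_comm u (pdx (pdx u)),
      l2inner_comm u (pdy (pdy u)), hxx, hyy, hxy] at h
    rw [sobolevSq_zero_eq_l2inner, h]
    simp only [sobolevSq.eq_2, sobolevSq_zero_eq_l2inner, pdx_pdy_comm hu]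
    ring
  | succ k ih =>
    rw [sobolevSq, ih hu, ih hu.pdx, ih hu.pdy, sobolevSq, pdx_Aop hu, pdy_Aop hu]

theorem sobolevSq_two_mul (m : ℕ) (hu : SmoothPeriodic u) :
    sobolevSq (2 * m) u = l2norm (Aop^[m] u) ^ 2 := by
  induction m generalizing u with
  | zero => exact (l2norm_sq u).symm
  | succ m ih => rw [Nat.mul_succ, sobolevSq_add_two _ hu, ih hu.Aop, Function.iterate_succ_apply]

/-- The one-dimensional Sobolev inequality on `[0, 2π]`. -/
theorem sq_le_two_mul_integral {g g' : ℝ → ℝ} (hg : ∀ x, HasDerivAt g (g' x) x)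
    (hg' : Continuous g') {x : ℝ} (hx : x ∈ Set.Icc 0 (2 * Real.pi)) :
    g x ^ 2 ≤ 2 * ∫ t in Set.Icc 0 (2 * Real.pi), (g t ^ 2 + g' t ^ 2) := by
  have hgc : Continuous g := continuous_iff_continuousAt.2 fun x => (hg x).continuousAt
  have hint {f : ℝ → ℝ} (hf : Continuous f) : IntegrableOn f (Set.Icc 0 (2 * Real.pi)) :=
    hf.continuousOn.integrableOn_compact isCompact_Icc
  obtain ⟨t, ht, hmin⟩ := isCompact_Icc.exists_isMinOn ⟨x, hx⟩ (hgc.pow 2).continuousOn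
  have hmean : g t ^ 2 ≤ ∫ s in Set.Icc 0 (2 * Real.pi), g s ^ 2 := by
    have h : ∫ _ in Set.Icc 0 (2 * Real.pi), g t ^ 2 ≤
        ∫ s in Set.Icc 0 (2 * Real.pi), g s ^ 2 :=
      setIntegral_mono_on (hint continuous_const) (hint (hgc.pow 2)) measurableSet_Icc
        fun s hs => hmin hs
    have hpi := Real.pi_gt_three
    rw [setIntegral_const, Real.volume_real_Icc_of_le (by positivity), smul_eq_mul] at h
    nlinarith [sq_nonneg (g t)]
  have hosc : g x ^ 2 - g t ^ 2 ≤
      ∫ s in Set.Icc 0 (2 * Real.pi), (g s ^ 2 + g' s ^ 2) := by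
    have hc : Continuous fun s => 2 * g s * g' s := (continuous_const.mul hgc).mul hg'
    have hftc : ∫ s in t..x, 2 * g s * g' s = g x ^ 2 - g t ^ 2 :=
      intervalIntegral.integral_eq_sub_of_hasDerivAt
        (fun s _ => by simpa using (hg s).pow 2) (hc.intervalIntegrable _ _)
    have hsub : Set.uIoc t x ⊆ Set.Icc 0 (2 * Real.pi) :=
      Set.uIoc_subset_uIcc.trans (Set.uIcc_subset_Icc ht hx)
    have hc' : Continuous fun s => g s ^ 2 + g' s ^ 2 := (hgc.pow 2).add (hg'.pow 2)
    calc g x ^ 2 - g t ^ 2 ≤ |∫ s in t..x, 2 * g s * g' s| := hftc ▸ le_abs_self _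
      _ ≤ ∫ s in Set.uIoc t x, |2 * g s * g' s| :=
        intervalIntegral.norm_integral_le_integral_norm_uIoc (f := fun s => 2 * g s * g' s)
      _ ≤ ∫ s in Set.uIoc t x, (g s ^ 2 + g' s ^ 2) := by
        refine setIntegral_mono ((hint hc.abs).mono_set hsub) ((hint hc').mono_set hsub) fun s => ?_
        exact abs_le.2 ⟨by nlinarith [sq_nonneg (g s + g' s)], two_mul_le_add_sq _ _⟩
      _ ≤ _ := setIntegral_mono_set (hint hc') (.of_forall fun s => by positivity)
        hsub.eventuallyLE
  have hsplit : ∫ s in Set.Icc 0 (2 * Real.pi), g s ^ 2 ≤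
      ∫ s in Set.Icc 0 (2 * Real.pi), (g s ^ 2 + g' s ^ 2) :=
    integral_mono (hint (hgc.pow 2)) (hint ((hgc.pow 2).add (hg'.pow 2)))
      fun s => le_add_of_nonneg_right (sq_nonneg _)
  linarith

/-- Ladyzhenskaya's inequality for a product. -/
theorem sobolevSq_zero_mul_le (hu : SmoothPeriodic u) (hv : SmoothPeriodic v) :
    sobolevSq 0 (fun p => u p * v p) ≤ 4 * (sobolevSq 1 u * sobolevSq 1 v) := by
  have hux := hu.sq.add hu.pdx.sq
  have hvy := hv.sq.add hv.pdy.sq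
  set F : ℝ → ℝ := fun y =>
    ∫ x in Set.Icc 0 (2 * Real.pi), (u (x, y) ^ 2 + pdx u (x, y) ^ 2) with hF
  set G : ℝ → ℝ := fun x =>
    ∫ y in Set.Icc 0 (2 * Real.pi), (v (x, y) ^ 2 + pdy v (x, y) ^ 2) with hG
  have hFint : IntegrableOn F (Set.Icc 0 (2 * Real.pi)) := by
    have h := hux.integrableOn
    rw [IntegrableOn, sq2, Measure.volume_eq_prod, ← Measure.prod_restrict] at h
    exact h.integral_prod_right
  have hGint : IntegrableOn G (Set.Icc 0 (2 * Real.pi)) := by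
    have h := hvy.integrableOn
    rw [IntegrableOn, sq2, Measure.volume_eq_prod, ← Measure.prod_restrict] at h
    exact h.integral_prod_left
  have hFle : ∫ y in Set.Icc 0 (2 * Real.pi), F y ≤ sobolevSq 1 u := by
    rw [hF, ← setIntegral_sq2_symm hux,
      integral_add hu.sq.integrableOn hu.pdx.sq.integrableOn]
    exact le_add_of_nonneg_right (sobolevSq_nonneg 0 (pdy u))
  have hGle : ∫ x in Set.Icc 0 (2 * Real.pi), G x ≤ sobolevSq 1 v := by
    rw [hG, ← setIntegral_sq2 hvy, integral_add hv.sq.integrableOn hv.pdy.sq.integrableOn]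
    have := sobolevSq_nonneg 0 (pdx v)
    simp only [sobolevSq] at this ⊢
    linarith
  have hF0 (y : ℝ) : 0 ≤ F y := integral_nonneg fun x => by positivity
  have hG0 (x : ℝ) : 0 ≤ G x := integral_nonneg fun y => by positivity
  have hmul : IntegrableOn (fun p : ℝ × ℝ => G p.1 * F p.2) sq2 := by
    rw [IntegrableOn, sq2, Measure.volume_eq_prod, ← Measure.prod_restrict]
    exact hGint.mul_prod hFint
  calc sobolevSq 0 (fun p => u p * v p)
      ≤ ∫ p in sq2, 4 * (G p.1 * F p.2) := by
        refine setIntegral_mono_on (hu.mul hv).sq.integrableOn (hmul.const_mul 4)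
          (measurableSet_Icc.prod measurableSet_Icc) fun p hp => ?_
        obtain ⟨x, y⟩ := p
        have h₁ : u (x, y) ^ 2 ≤ 2 * F y :=
          sq_le_two_mul_integral (fun t => hu.hasDerivAt_fst t y)
            (hu.pdx.continuous.comp (by fun_prop)) hp.1
        have h₂ : v (x, y) ^ 2 ≤ 2 * G x :=
          sq_le_two_mul_integral (fun t => hv.hasDerivAt_snd x t)
            (hv.pdy.continuous.comp (by fun_prop)) hp.2
        have := mul_le_mul h₁ h₂ (sq_nonneg _) (by linarith [hF0 y])
        rw [mul_pow]
        linarith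
    _ = 4 * ((∫ x in Set.Icc 0 (2 * Real.pi), G x) * ∫ y in Set.Icc 0 (2 * Real.pi), F y) := by
        rw [integral_const_mul, sq2, Measure.volume_eq_prod, setIntegral_prod_mul]
    _ ≤ 4 * (sobolevSq 1 u * sobolevSq 1 v) := by
        rw [mul_comm (sobolevSq 1 u)]
        exact mul_le_mul_of_nonneg_left (mul_le_mul hGle hFle
          (setIntegral_nonneg measurableSet_Icc fun y _ => hF0 y) (sobolevSq_nonneg _ _))
          (by norm_num)

end Sobolev

theorem exists_sobolevSq_mul_le (k : ℕ) : ∃ C ≥ 0, ∀ u v : ℝ × ℝ → ℝ,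
    SmoothPeriodic u → SmoothPeriodic v →
      sobolevSq k (fun p => u p * v p) ≤ C * (sobolevSq (k + 1) u * sobolevSq (k + 1) v) := by
  induction k with
  | zero => exact ⟨4, by norm_num, fun u v hu hv => sobolevSq_zero_mul_le hu hv⟩
  | succ k ih =>
    obtain ⟨C, hC, h⟩ := ih
    refine ⟨9 * C, by positivity, fun u v hu hv => ?_⟩
    set P := C * (sobolevSq (k + 1 + 1) u * sobolevSq (k + 1 + 1) v) with hP
    have key {f g : ℝ × ℝ → ℝ} (hf : SmoothPeriodic f) (hg : SmoothPeriodic g)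
        (hfu : sobolevSq (k + 1) f ≤ sobolevSq (k + 1 + 1) u)
        (hgv : sobolevSq (k + 1) g ≤ sobolevSq (k + 1 + 1) v) :
        sobolevSq k (fun p => f p * g p) ≤ P :=
      (h f g hf hg).trans <| mul_le_mul_of_nonneg_left
        (mul_le_mul hfu hgv (sobolevSq_nonneg _ _) (sobolevSq_nonneg _ _)) hC
    have hu' := sobolevSq_le_succ (k + 1) u
    have hv' := sobolevSq_le_succ (k + 1) v
    have h₀ := key hu hv hu' hv'
    have hx := sobolevSq_add_le k (hu.pdx.mul hv) (hu.mul hv.pdx)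
    have hx₁ := key hu.pdx hv (sobolevSq_pdx_le _ u) hv'
    have hx₂ := key hu hv.pdx hu' (sobolevSq_pdx_le _ v)
    have hy := sobolevSq_add_le k (hu.pdy.mul hv) (hu.mul hv.pdy)
    have hy₁ := key hu.pdy hv (sobolevSq_pdy_le _ u) hv'
    have hy₂ := key hu hv.pdy hu' (sobolevSq_pdy_le _ v)
    rw [sobolevSq, pdx_mul hu hv, pdy_mul hu hv]
    linarith

theorem exists_sobolevSq_mul_mul_le (k : ℕ) : ∃ C ≥ 0, ∀ u v w : ℝ × ℝ → ℝ,
    SmoothPeriodic u → SmoothPeriodic v → SmoothPeriodic w →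
      sobolevSq k (fun p => u p * (v p * w p)) ≤
        C * (sobolevSq (k + 2) u * (sobolevSq (k + 2) v * sobolevSq (k + 2) w)) := by
  obtain ⟨C, hC, h⟩ := exists_sobolevSq_mul_le k
  obtain ⟨D, hD, h'⟩ := exists_sobolevSq_mul_le (k + 1)
  refine ⟨C * D, by positivity, fun u v w hu hv hw => ?_⟩
  calc sobolevSq k (fun p => u p * (v p * w p))
      ≤ C * (sobolevSq (k + 1) u * sobolevSq (k + 1) (fun p => v p * w p)) :=
        h u _ hu (hv.mul hw)
    _ ≤ C * (sobolevSq (k + 2) u * (D * (sobolevSq (k + 2) v * sobolevSq (k + 2) w))) :=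
        mul_le_mul_of_nonneg_left (mul_le_mul (sobolevSq_le_succ _ _) (h' v w hv hw)
          (sobolevSq_nonneg _ _) (sobolevSq_nonneg _ _)) hC
    _ = _ := by ring

theorem exists_sobolevSq_gradDot_le (k : ℕ) : ∃ C ≥ 0, ∀ u v : ℝ × ℝ → ℝ,
    SmoothPeriodic u → SmoothPeriodic v →
      sobolevSq k (gradDot u v) ≤ C * (sobolevSq (k + 2) u * sobolevSq (k + 2) v) := by
  obtain ⟨C, hC, h⟩ := exists_sobolevSq_mul_le k
  refine ⟨4 * C, by positivity, fun u v hu hv => ?_⟩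
  have hadd := sobolevSq_add_le k (hu.pdx.mul hv.pdx) (hu.pdy.mul hv.pdy)
  have hx := (h _ _ hu.pdx hv.pdx).trans <| mul_le_mul_of_nonneg_left
    (mul_le_mul (sobolevSq_pdx_le (k + 1) u) (sobolevSq_pdx_le (k + 1) v)
      (sobolevSq_nonneg _ _) (sobolevSq_nonneg _ _)) hC
  have hy := (h _ _ hu.pdy hv.pdy).trans <| mul_le_mul_of_nonneg_left
    (mul_le_mul (sobolevSq_pdy_le (k + 1) u) (sobolevSq_pdy_le (k + 1) v)
      (sobolevSq_nonneg _ _) (sobolevSq_nonneg _ _)) hC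
  have heq : gradDot u v = fun p => pdx u p * pdx v p + pdy u p * pdy v p := rfl
  rw [heq]
  linarith

theorem SmoothPeriodic.gradDot {u v : ℝ × ℝ → ℝ} (hu : SmoothPeriodic u)
    (hv : SmoothPeriodic v) : SmoothPeriodic (gradDot u v) :=
  (hu.pdx.mul hv.pdx).add (hu.pdy.mul hv.pdy)

theorem SmoothPeriodic.fNL (a b : ℝ) {u : ℝ × ℝ → ℝ} (hu : SmoothPeriodic u) :
    SmoothPeriodic (fNL a b u) := by
  have h := (((hu.const_mul (a + 3)).sub (hu.Aop.const_mul 4)).add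
    ((hu.gradDot hu).const_mul b)).add (hu.mul (hu.mul hu))
  convert h using 2 with p
  simp only [_root_.fNL]
  ring

theorem fNL_sub_fNL (a b : ℝ) {u₁ u₂ : ℝ × ℝ → ℝ} (h₁ : SmoothPeriodic u₁)
    (h₂ : SmoothPeriodic u₂) :
    (fun p => fNL a b u₂ p - fNL a b u₁ p) = fun p =>
      ((a + 3) * (u₂ p - u₁ p) + -4 * Aop (fun p => u₂ p - u₁ p) p) +
      (b * gradDot (fun p => u₂ p - u₁ p) (fun p => u₁ p + u₂ p) p +
      ((u₂ p - u₁ p) * ((u₁ p + u₂ p) * (u₁ p + u₂ p)) +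
        -1 * ((u₂ p - u₁ p) * (u₁ p * u₂ p)))) := by
  have hsub : (fun p => u₂ p - u₁ p) = fun p => u₂ p + -1 * u₁ p := by ext p; ring
  have hn := h₁.const_mul (-1)
  ext p
  simp only [fNL, gradDot, Aop, hsub, pdx_add h₂ hn, pdy_add h₂ hn, pdx_add h₁ h₂, pdy_add h₁ h₂,
    pdx_const_mul _ h₁, pdy_const_mul _ h₁,
    pdx_add h₂.pdx (h₁.pdx.const_mul (-1)), pdy_add h₂.pdy (h₁.pdy.const_mul (-1)),
    pdx_const_mul _ h₁.pdx, pdy_const_mul _ h₁.pdy]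
  ring

theorem exists_sobolevSq_fNL_sub_le (a b : ℝ) (k : ℕ) : ∃ C ≥ 0, ∀ u₁ u₂ : ℝ × ℝ → ℝ,
    SmoothPeriodic u₁ → SmoothPeriodic u₂ →
      sobolevSq k (fun p => fNL a b u₂ p - fNL a b u₁ p) ≤
        C * sobolevSq (k + 2) (fun p => u₂ p - u₁ p) *
          (1 + sobolevSq (k + 2) u₁ ^ 2 + sobolevSq (k + 2) u₂ ^ 2) := by
  obtain ⟨C, hC, hgrad⟩ := exists_sobolevSq_gradDot_le k
  obtain ⟨D, hD, hcub⟩ := exists_sobolevSq_mul_mul_le k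
  refine ⟨4 * ((a + 3) ^ 2 + 16) + 8 * b ^ 2 * C + 80 * D, by positivity,
    fun u₁ u₂ h₁ h₂ => ?_⟩
  have hv := h₂.sub h₁
  have hs := h₁.add h₂
  rw [fNL_sub_fNL a b h₁ h₂]
  set v : ℝ × ℝ → ℝ := fun p => u₂ p - u₁ p with hvdef
  set s : ℝ × ℝ → ℝ := fun p => u₁ p + u₂ p with hsdef
  have e₁ := sobolevSq_add_le k ((hv.const_mul (a + 3)).add (hv.Aop.const_mul (-4)))
    (((hv.gradDot hs).const_mul b).add
      ((hv.mul (hs.mul hs)).add ((hv.mul (h₁.mul h₂)).const_mul (-1))))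
  have e₂ := sobolevSq_add_le k (hv.const_mul (a + 3)) (hv.Aop.const_mul (-4))
  have e₃ := sobolevSq_add_le k ((hv.gradDot hs).const_mul b)
    ((hv.mul (hs.mul hs)).add ((hv.mul (h₁.mul h₂)).const_mul (-1)))
  have e₄ := sobolevSq_add_le k (hv.mul (hs.mul hs)) ((hv.mul (h₁.mul h₂)).const_mul (-1))
  rw [sobolevSq_const_mul k _ hv, sobolevSq_const_mul k _ hv.Aop, ← sobolevSq_add_two k hv] at e₂
  rw [sobolevSq_const_mul k _ (hv.gradDot hs)] at e₃
  rw [sobolevSq_const_mul k _ (hv.mul (h₁.mul h₂))] at e₄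
  have hlin := (sobolevSq_le_succ k v).trans (sobolevSq_le_succ (k + 1) v)
  have hg := hgrad v s hv hs
  have hc₁ := hcub v s s hv hs hs
  have hc₂ := hcub v u₁ u₂ hv h₁ h₂
  have hS := sobolevSq_add_le (k + 2) h₁ h₂
  have hV0 := sobolevSq_nonneg (k + 2) v
  have hS0 := sobolevSq_nonneg (k + 2) s
  have hX0 := sobolevSq_nonneg (k + 2) u₁
  have hY0 := sobolevSq_nonneg (k + 2) u₂
  simp only [← hsdef] at hS
  set V := sobolevSq (k + 2) v
  set S := sobolevSq (k + 2) s
  set X := sobolevSq (k + 2) u₁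
  set Y := sobolevSq (k + 2) u₂
  have hR : 1 ≤ 1 + X ^ 2 + Y ^ 2 := by nlinarith [sq_nonneg X, sq_nonneg Y]
  have hSR : S ≤ 2 * (1 + X ^ 2 + Y ^ 2) := by
    nlinarith [sq_nonneg (X - 1), sq_nonneg (Y - 1)]
  have hSSR : S * S ≤ 8 * (1 + X ^ 2 + Y ^ 2) := by
    nlinarith [mul_le_mul hS hS hS0 (by positivity), sq_nonneg (X - Y)]
  have hXYR : X * Y ≤ 1 + X ^ 2 + Y ^ 2 := by nlinarith [sq_nonneg (X - Y)]
  set R := 1 + X ^ 2 + Y ^ 2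
  have b₀ : V ≤ V * R := le_mul_of_one_le_right hV0 hR
  have b₁ : (a + 3) ^ 2 * sobolevSq k v ≤ (a + 3) ^ 2 * (V * R) :=
    mul_le_mul_of_nonneg_left (hlin.trans b₀) (sq_nonneg _)
  have b₂ : b ^ 2 * sobolevSq k (gradDot v s) ≤ b ^ 2 * (C * (V * (2 * R))) :=
    mul_le_mul_of_nonneg_left (hg.trans (by gcongr)) (sq_nonneg _)
  have b₃ := hc₁.trans (show _ ≤ D * (V * (8 * R)) by gcongr)
  have b₄ := hc₂.trans (show _ ≤ D * (V * R) by gcongr)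
  have hDVR : 0 ≤ D * (V * R) := by positivity
  linarith

theorem abs_l2inner_le {u v : ℝ × ℝ → ℝ} (hu : SmoothPeriodic u) (hv : SmoothPeriodic v)
    {ε : ℝ} (hε : 0 < ε) :
    |l2inner u v| ≤ ε * l2norm u ^ 2 + ε⁻¹ * l2norm v ^ 2 := by
  have hbound (p : ℝ × ℝ) : |u p * v p| ≤ ε * u p ^ 2 + ε⁻¹ * v p ^ 2 := by
    have h : ε * u p ^ 2 + ε⁻¹ * v p ^ 2 =
        ε⁻¹ * ((ε * |u p|) ^ 2 + |v p| ^ 2) := by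
      rw [mul_pow, sq_abs, sq_abs]; field_simp
    have h' : |u p * v p| = ε⁻¹ * ((ε * |u p|) * |v p|) := by
      rw [abs_mul]; field_simp
    rw [h, h']
    gcongr
    nlinarith [sq_nonneg (ε * |u p| - |v p|), sq_nonneg (ε * |u p|), sq_nonneg |v p|]
  rw [l2norm_sq, l2norm_sq]
  simp only [sobolevSq]
  rw [← integral_const_mul, ← integral_const_mul,
    ← integral_add (hu.sq.const_mul ε).integrableOn (hv.sq.const_mul ε⁻¹).integrableOn]
  exact (abs_integral_le_integral_abs).trans <| integral_mono (hu.mul hv).integrableOn.abs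
    ((hu.sq.const_mul ε).add (hv.sq.const_mul ε⁻¹)).integrableOn hbound

/-- Estimate for `|(A^m v, A^m (f(u₂) − f(u₁)))|` with `v = u₂ − u₁`. -/
theorem stmt_12 (a b : ℝ) (m : ℕ) (hm : 1 ≤ m) :
    ∀ ε > (0 : ℝ), ∃ c > 0, ∀ u₁ u₂ : ℝ × ℝ → ℝ,
      SmoothPeriodic u₁ → SmoothPeriodic u₂ →
      |l2inner (Aop^[m] (fun p => u₂ p - u₁ p))
          (Aop^[m] (fun p => fNL a b u₂ p - fNL a b u₁ p))| ≤
        ε * l2norm (Aop^[m + 1] (fun p => u₂ p - u₁ p)) ^ 2 +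
          c * l2norm (Aop^[m] (fun p => u₂ p - u₁ p)) ^ 2 *
            (1 + l2norm (Aop^[m] u₁) ^ 4 + l2norm (Aop^[m] u₂) ^ 4) := by
  intro ε hε
  obtain ⟨m, rfl⟩ : ∃ n, m = n + 1 := ⟨m - 1, by omega⟩
  obtain ⟨C, hC, h⟩ := exists_sobolevSq_fNL_sub_le a b (2 * m)
  refine ⟨ε⁻¹ * C + 1, by positivity, fun u₁ u₂ h₁ h₂ => ?_⟩
  have hv := h₂.sub h₁
  have hF := (h₂.fNL a b).sub (h₁.fNL a b)
  have hd : 2 * m + 2 = 2 * (m + 1) := by ring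
  have hE := h u₁ u₂ h₁ h₂
  rw [hd, sobolevSq_two_mul _ hF, sobolevSq_two_mul _ hv, sobolevSq_two_mul _ h₁,
    sobolevSq_two_mul _ h₂, ← pow_mul, ← pow_mul, show 2 * 2 = 4 from rfl] at hE
  rw [Function.iterate_succ_apply' Aop m (fun p => fNL a b u₂ p - fNL a b u₁ p),
    ← l2inner_Aop_left (hv.Aop_iterate _) (hF.Aop_iterate _),
    ← Function.iterate_succ_apply' Aop (m + 1)]
  refine (abs_l2inner_le (hv.Aop_iterate _) (hF.Aop_iterate _) hε).trans ?_
  have hmul := mul_le_mul_of_nonneg_left hE (inv_nonneg.2 hε.le)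
  have hpos : 0 ≤ l2norm (Aop^[m + 1] fun p => u₂ p - u₁ p) ^ 2 *
      (1 + l2norm (Aop^[m + 1] u₁) ^ 4 + l2norm (Aop^[m + 1] u₂) ^ 4) := by positivity
  rw [Nat.succ_eq_add_one]
  linarith
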